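/- Let I ⊎ U be a canonical paired threshold partition of a paired threshold graph G, and let v ∈ U ∖ N(I) be a simplicial vertex of G. Then the subgraph of G induced by the closed neighborhood N[I ∪ {v}] is not a threshold graph. -/

import Mathlib

/-- `G` is a paired threshold graph: there are positive vertex weights and two
positive thresholds such that distinct vertices are adjacent iff their weight
sum is at least `Tp` and their weight difference is at most `Tm`. -/
def IsPairedThresholdGraph {V : Type*} (G : SimpleGraph V) : Prop :=
  ∃ (w : V → ℝ) (Tp Tm : ℝ), (∀ v, 0 < w v) ∧ 0 < Tp ∧ 0 < Tm ∧
    ∀ u v, u ≠ v → (G.Adj u v ↔ Tp ≤ w u + w v ∧ |w u - w v| ≤ Tm)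

/-- `G` is an interval graph: vertices can be assigned nonempty closed real
intervals so that distinct vertices are adjacent iff their intervals meet. -/
def IsIntervalGraph {V : Type*} (G : SimpleGraph V) : Prop :=
  ∃ l r : V → ℝ, (∀ v, l v ≤ r v) ∧
    ∀ u v, u ≠ v →
      (G.Adj u v ↔ (Set.Icc (l u) (r u) ∩ Set.Icc (l v) (r v)).Nonempty)

/-- `G` is a unit interval graph: vertices can be assigned closed real intervals
of length one so that distinct vertices are adjacent iff their intervals meet. -/
def IsUnitIntervalGraph {V : Type*} (G : SimpleGraph V) : Prop :=
  ∃ l : V → ℝ,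
    ∀ u v, u ≠ v →
      (G.Adj u v ↔ (Set.Icc (l u) (l u + 1) ∩ Set.Icc (l v) (l v + 1)).Nonempty)

/-- `G` is a threshold graph: there are positive vertex weights and a positive
threshold such that distinct vertices are adjacent iff their weight sum is at
least `T`. -/
def IsThresholdGraph {V : Type*} (G : SimpleGraph V) : Prop :=
  ∃ (w : V → ℝ) (T : ℝ), (∀ v, 0 < w v) ∧ 0 < T ∧
    ∀ u v, u ≠ v → (G.Adj u v ↔ T ≤ w u + w v)

/-- Closed neighborhood `N[X]` of a vertex set. -/
def closedNbhd {V : Type*} (G : SimpleGraph V) (X : Set V) : Set V :=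
  X ∪ {u | ∃ x ∈ X, G.Adj x u}

/-- Open neighborhood `N(X)` of a vertex set. -/
def openNbhd {V : Type*} (G : SimpleGraph V) (X : Set V) : Set V :=
  closedNbhd G X \ X

/-- A vertex is simplicial if its closed neighborhood is a clique. -/
def IsSimplicial {V : Type*} (G : SimpleGraph V) (v : V) : Prop :=
  G.IsClique (insert v (G.neighborSet v))

/-- A broom ordering of `G` (vertices indexed `0, …, n-1` by the bijection `σ`):
the reversal of `σ` is an interval ordering, and there is `p` such that the first
`p` vertices have all their neighbors after position `p`, occupying consecutive
positions, while the last `n - p` vertices form an umbrella ordering. -/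
def IsBroomOrdering {V : Type*} [Fintype V] (G : SimpleGraph V)
    (σ : V ≃ Fin (Fintype.card V)) : Prop :=
  (∀ x y z : V, σ x < σ y → σ y < σ z → G.Adj x z → G.Adj y z) ∧
  ∃ p : ℕ, p ≤ Fintype.card V ∧
    (∀ u : V, (σ u : ℕ) < p →
      (∀ v : V, G.Adj u v → p ≤ (σ v : ℕ)) ∧
      (∀ a b c : Fin (Fintype.card V),
        (∃ x, G.Adj u x ∧ σ x = a) → (∃ x, G.Adj u x ∧ σ x = c) →
        a ≤ b → b ≤ c → ∃ x, G.Adj u x ∧ σ x = b)) ∧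
    (∀ x y z : V, p ≤ (σ x : ℕ) → σ x < σ y → σ y < σ z →
      G.Adj x z → G.Adj x y ∧ G.Adj y z)

/-- An umbrella ordering of a graph `H`. -/
def IsUmbrellaOrdering {W : Type*} (H : SimpleGraph W) (σ : W ≃ Fin (Nat.card W)) : Prop :=
  ∀ x y z : W, σ x < σ y → σ y < σ z → H.Adj x z → H.Adj x y ∧ H.Adj y z

/-- `I ⊎ U` is a paired threshold partition of `G`. -/
def IsPairedThresholdPartition {V : Type*} (G : SimpleGraph V) (I U : Set V) : Prop :=
  I ∪ U = Set.univ ∧ Disjoint I U ∧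
  (∀ x ∈ I, ∀ y ∈ I, ¬ G.Adj x y) ∧
  IsUnitIntervalGraph (G.induce U) ∧
  IsThresholdGraph (G.induce (closedNbhd G I)) ∧
  ∃ σ : ↥U ≃ Fin (Nat.card ↥U),
    IsUmbrellaOrdering (G.induce U) σ ∧
    (∀ v ∈ I, ∀ a b c : Fin (Nat.card ↥U),
      (∃ x : ↥U, G.Adj v ↑x ∧ σ x = a) → (∃ x : ↥U, G.Adj v ↑x ∧ σ x = c) →
      a ≤ b → b ≤ c → ∃ x : ↥U, G.Adj v ↑x ∧ σ x = b) ∧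
    (∀ u : ↥U, (σ u : ℕ) = 0 → openNbhd G I ⊆ insert (↑u) (G.neighborSet ↑u))

/-- A canonical paired threshold partition: `I` cannot be enlarged by moving a
vertex of `U` into it. -/
def IsCanonicalPTPartition {V : Type*} (G : SimpleGraph V) (I U : Set V) : Prop :=
  IsPairedThresholdPartition G I U ∧
  ∀ v ∈ U, ¬ IsPairedThresholdPartition G (insert v I) (U \ {v})

/-- A maximal clique of `G`. -/
def IsMaximalClique {V : Type*} (G : SimpleGraph V) (s : Set V) : Prop :=
  G.IsClique s ∧ ∀ t : Set V, G.IsClique t → s ⊆ t → s = t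

/-- A clique path of `G`: a sequence listing each maximal clique exactly once,
in which the cliques containing any fixed vertex occur consecutively. -/
def IsCliquePath {V : Type*} (G : SimpleGraph V) {ℓ : ℕ} (C : Fin ℓ → Set V) : Prop :=
  Function.Injective C ∧
  (∀ i, IsMaximalClique G (C i)) ∧
  (∀ s : Set V, IsMaximalClique G s → ∃ i, C i = s) ∧
  (∀ v : V, ∀ i j k : Fin ℓ, i ≤ j → j ≤ k → v ∈ C i → v ∈ C k → v ∈ C j)

theorem mem_openNbhd_iff {V : Type*} {G : SimpleGraph V} {X : Set V} {z : V} :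
    z ∈ openNbhd G X ↔ z ∉ X ∧ ∃ x ∈ X, G.Adj x z := by
  simp only [openNbhd, closedNbhd, Set.mem_sdiff, Set.mem_union, Set.mem_ofPred_eq]
  tauto

/-- An injection of a finite type into `ℕ` can be compressed to an enumeration in the same order. -/
theorem exists_equiv_fin_lt_iff {W : Type*} [Finite W] (f : W → ℕ) (hf : Function.Injective f) :
    ∃ σ : W ≃ Fin (Nat.card W), ∀ x y, σ x < σ y ↔ f x < f y := by
  have := Fintype.ofFinite W
  let _ : LinearOrder W := LinearOrder.lift' f hf
  let e := Fintype.orderIsoFinOfCardEq W (Nat.card_eq_fintype_card (α := W)).symm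
  exact ⟨e.symm.toEquiv, fun x y => e.symm.lt_iff_lt⟩

theorem isThresholdGraph_induce_iff {V : Type*} {G : SimpleGraph V} {S : Set V} :
    IsThresholdGraph (G.induce S) ↔ ∃ (w : V → ℝ) (T : ℝ), (∀ v ∈ S, 0 < w v) ∧ 0 < T ∧
      ∀ u ∈ S, ∀ v ∈ S, u ≠ v → (G.Adj u v ↔ T ≤ w u + w v) := by
  classical
  constructor
  · rintro ⟨w, T, hw, hT, h⟩
    refine ⟨fun x => if hx : x ∈ S then w ⟨x, hx⟩ else 0, T, ?_, hT, ?_⟩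
    · intro v hv
      simpa [hv] using hw ⟨v, hv⟩
    · intro u hu v hv huv
      simpa [hu, hv] using h ⟨u, hu⟩ ⟨v, hv⟩ (by simpa using huv)
  · rintro ⟨w, T, hw, hT, h⟩
    exact ⟨fun x => w x, T, fun x => hw x x.2, hT,
      fun u v huv => h u u.2 v v.2 (fun e => huv (Subtype.ext e))⟩

theorem IsUnitIntervalGraph.induce_mono {V : Type*} {G : SimpleGraph V} {S S' : Set V}
    (hS : S ⊆ S') (h : IsUnitIntervalGraph (G.induce S')) : IsUnitIntervalGraph (G.induce S) := by
  obtain ⟨l, hl⟩ := h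
  refine ⟨fun x => l ⟨x, hS x.2⟩, fun u v huv => ?_⟩
  exact hl ⟨u, hS u.2⟩ ⟨v, hS v.2⟩ (fun e =>
    huv (Subtype.ext (congrArg (fun t : ↥S' => (t : V)) e)))

/-- If `X` is independent and `N[X]` induces a threshold graph, the neighborhoods of vertices of `X`
are nested. -/
theorem neighborSet_subset_or_of_threshold {V : Type*} {G : SimpleGraph V} {X : Set V}
    (hth : IsThresholdGraph (G.induce (closedNbhd G X))) (hind : ∀ x ∈ X, ∀ y ∈ X, ¬ G.Adj x y)
    {x v : V} (hx : x ∈ X) (hv : v ∈ X) :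
    G.neighborSet v ⊆ G.neighborSet x ∨ G.neighborSet x ⊆ G.neighborSet v := by
  obtain ⟨w, T, -, -, h⟩ := isThresholdGraph_induce_iff.1 hth
  have key : ∀ a ∈ X, ∀ b ∈ X, w a ≤ w b → G.neighborSet a ⊆ G.neighborSet b := by
    intro a ha b hb hab z haz
    have haz' : G.Adj a z := haz
    have hz : z ∈ closedNbhd G X := Or.inr ⟨a, ha, haz'⟩
    have hbz : b ≠ z := fun e => hind a ha b hb (e ▸ haz')
    have h₁ := (h a (Or.inl ha) z hz haz'.ne).1 haz'
    exact (h b (Or.inl hb) z hz hbz).2 (by linarith)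
  exact (le_total (w v) (w x)).imp (key v hv x hx) (key x hx v hv)

/-- Adding to `I` a simplicial vertex whose neighborhood contains `N(I)` keeps the graph induced by
the closed neighborhood threshold. -/
theorem isThresholdGraph_closedNbhd_insert {V : Type*} [Finite V] {G : SimpleGraph V} {I : Set V}
    {u : V} (hind : ∀ x ∈ I, ∀ y ∈ I, ¬ G.Adj x y) (huI : u ∉ I) (hu : ∀ x ∈ I, ¬ G.Adj x u)
    (hsimp : IsSimplicial G u) (hN : ∀ z ∈ openNbhd G I, G.Adj u z)
    (hth : IsThresholdGraph (G.induce (closedNbhd G I))) :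
    IsThresholdGraph (G.induce (closedNbhd G (insert u I))) := by
  classical
  obtain ⟨w, T, hw, hT, h⟩ := isThresholdGraph_induce_iff.1 hth
  obtain ⟨M, hTM, hM⟩ : ∃ M, T ≤ M ∧ ∀ x, w x ≤ M := by
    obtain ⟨M, hM⟩ := (Set.finite_range w).bddAbove
    exact ⟨max M T, le_max_right _ _, fun x => (hM ⟨x, rfl⟩).trans (le_max_left _ _)⟩
  have hNI : ∀ z, z ∉ I → z ∈ closedNbhd G I → G.Adj u z := fun z hz hz' => hN z ⟨hz', hz⟩
  have hcl : ∀ y z, G.Adj u y → G.Adj u z → y ≠ z → G.Adj y z :=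
    fun y z hy hz hyz => hsimp (Or.inr hy) (Or.inr hz) hyz
  have hmem : ∀ z ∈ closedNbhd G (insert u I), z ≠ u → z ∉ I → G.Adj u z := by
    rintro z (hz | ⟨x, rfl | hx, hxz⟩) hzu hzI
    · exact absurd hz (by simp [hzu, hzI])
    · exact hxz
    · exact hN z (mem_openNbhd_iff.2 ⟨hzI, x, hx, hxz⟩)
  have huN : u ∉ closedNbhd G I := fun hu' => (hNI u huI hu').ne rfl
  have hIN : ∀ x ∈ I, x ∈ closedNbhd G I := fun x hx => Or.inl hx
  -- Clique vertices are shifted up by `2M + 2 + T`, as is the threshold.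
  let W : V → ℝ := fun x =>
    if x ∈ I then w x else if x = u then M + 1
    else if x ∈ closedNbhd G I then w x + (2 * M + 2 + T) else M + 1 + 2 * T
  have hWI : ∀ x ∈ I, W x = w x := fun x hx => by simp [W, hx]
  have hWu : W u = M + 1 := by simp [W, huI]
  have hWN : ∀ x ∉ I, x ∈ closedNbhd G I → W x = w x + (2 * M + 2 + T) := by
    intro x hx hx'
    have : x ≠ u := fun e => huN (e ▸ hx')
    simp [W, hx, hx', this]
  have hWO : ∀ x, x ≠ u → x ∉ closedNbhd G I → W x = M + 1 + 2 * T := by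
    intro x hx hx'
    have : x ∉ I := fun e => hx' (hIN x e)
    simp [W, hx, hx', this]
  have hWC : ∀ x ∉ I, x ≠ u → M + 1 + 2 * T ≤ W x := by
    intro x hx hxu
    by_cases hx' : x ∈ closedNbhd G I
    · have := hw x hx'
      rw [hWN x hx hx']; linarith
    · rw [hWO x hxu hx']
  have hII : ∀ x ∈ I, ∀ z ∈ closedNbhd G (insert u I), x ≠ z →
      (G.Adj x z ↔ 2 * M + 2 + 2 * T ≤ W x + W z) := by
    intro x hx z hz hxz
    have hxM := hM x
    by_cases hzI : z ∈ I
    · have := hM z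
      rw [hWI x hx, hWI z hzI]
      exact iff_of_false (hind x hx z hzI) (by linarith)
    by_cases hzu : z = u
    · subst hzu
      rw [hWI x hx, hWu]
      exact iff_of_false (hu x hx) (by linarith)
    by_cases hzN : z ∈ closedNbhd G I
    · rw [h x (hIN x hx) z hzN hxz, hWI x hx, hWN z hzI hzN]
      constructor <;> intro <;> linarith
    · rw [hWI x hx, hWO z hzu hzN]
      exact iff_of_false (fun hxz' => hzN (Or.inr ⟨x, hx, hxz'⟩)) (by linarith)
  have hUU : ∀ z ∈ closedNbhd G (insert u I), z ≠ u → z ∉ I →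
      (G.Adj u z ↔ 2 * M + 2 + 2 * T ≤ W u + W z) := by
    intro z hz hzu hzI
    have := hWC z hzI hzu
    rw [hWu]
    exact iff_of_true (hmem z hz hzu hzI) (by linarith)
  refine isThresholdGraph_induce_iff.2 ⟨W, 2 * M + 2 + 2 * T, ?_, by linarith, ?_⟩
  · intro x hx
    by_cases hxI : x ∈ I
    · rw [hWI x hxI]; exact hw x (hIN x hxI)
    by_cases hxu : x = u
    · rw [hxu, hWu]; linarith
    · have := hWC x hxI hxu
      linarith
  · intro x hx z hz hxz
    by_cases hxI : x ∈ I
    · exact hII x hxI z hz hxz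
    by_cases hzI : z ∈ I
    · rw [G.adj_comm, add_comm (W x)]; exact hII z hzI x hx hxz.symm
    by_cases hxu : x = u
    · subst hxu; exact hUU z hz hxz.symm hzI
    by_cases hzu : z = u
    · subst hzu; rw [G.adj_comm, add_comm (W x)]; exact hUU x hx hxz hxI
    have h₁ := hWC x hxI hxu
    have h₂ := hWC z hzI hzu
    exact iff_of_true (hcl x z (hmem x hx hxu hxI) (hmem z hz hzu hzI) hxz) (by linarith)

/-- Sufficient conditions for moving a vertex of `U` to `I`, keeping the order of the other
vertices of `U`. -/
theorem isPairedThresholdPartition_insert {V : Type*} [Finite V] {G : SimpleGraph V} {I U : Set V}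
    (hIU : I ∪ U = Set.univ) (hdisj : Disjoint I U) (hind : ∀ x ∈ I, ∀ y ∈ I, ¬ G.Adj x y)
    (hunit : IsUnitIntervalGraph (G.induce U)) (σ : ↥U ≃ Fin (Nat.card ↥U))
    (hσ : IsUmbrellaOrdering (G.induce U) σ)
    (hcons : ∀ v ∈ I, ∀ a b c : Fin (Nat.card ↥U),
      (∃ x : ↥U, G.Adj v ↑x ∧ σ x = a) → (∃ x : ↥U, G.Adj v ↑x ∧ σ x = c) →
      a ≤ b → b ≤ c → ∃ x : ↥U, G.Adj v ↑x ∧ σ x = b)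
    {v : V} (hv : v ∈ U) (hvI : ∀ x ∈ I, ¬ G.Adj x v)
    (hth : IsThresholdGraph (G.induce (closedNbhd G (insert v I))))
    (hfirst : ∀ u : ↥U, (u : V) ≠ v → (∀ y : ↥U, (y : V) ≠ v → σ u ≤ σ y) →
      openNbhd G (insert v I) ⊆ insert ↑u (G.neighborSet ↑u)) :
    IsPairedThresholdPartition G (insert v I) (U \ {v}) := by
  let ι : ↥(U \ {v}) → ↥U := fun x => ⟨x, x.2.1⟩
  have hι : Function.Injective ι := fun x y e => Subtype.ext (congrArg (fun z : ↥U => (z : V)) e)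
  obtain ⟨τ, hτ⟩ := exists_equiv_fin_lt_iff (fun x => (σ (ι x) : ℕ))
    (fun x y e => hι (σ.injective (Fin.ext e)))
  have hlt : ∀ x y, τ x < τ y ↔ σ (ι x) < σ (ι y) := hτ
  have hle : ∀ x y, τ x ≤ τ y ↔ σ (ι x) ≤ σ (ι y) := fun x y => by
    rw [← not_lt, ← not_lt, hlt]
  refine ⟨?_, ?_, ?_, hunit.induce_mono Set.sdiff_subset, hth, τ, ?_, ?_, ?_⟩
  · ext x
    have hx : x ∈ I ∪ U := hIU ▸ Set.mem_univ x
    by_cases hxv : x = v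
    · simp [hxv]
    · simpa [hxv] using hx
  · rw [Set.disjoint_left] at hdisj ⊢
    rintro x (rfl | hx) hxU
    · exact hxU.2 rfl
    · exact hdisj hx hxU.1
  · rintro x (rfl | hx) y (rfl | hy)
    · exact G.irrefl
    · exact fun e => hvI y hy e.symm
    · exact hvI x hx
    · exact hind x hx y hy
  · intro x y z hxy hyz hxz
    exact hσ (ι x) (ι y) (ι z) ((hlt _ _).1 hxy) ((hlt _ _).1 hyz) hxz
  · rintro x hx a b c ⟨p, hp, rfl⟩ ⟨r, hr, rfl⟩ hab hbc
    obtain ⟨q, rfl⟩ := τ.surjective b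
    refine ⟨q, ?_, rfl⟩
    rw [hle] at hab hbc
    rcases hx with rfl | hx
    · rcases lt_trichotomy (σ ⟨x, hv⟩) (σ (ι q)) with hlt' | heq | hgt
      · rcases hbc.lt_or_eq with hbc | hbc
        · exact (hσ ⟨x, hv⟩ (ι q) (ι r) hlt' hbc hr).1
        · rw [hι (σ.injective hbc)]; exact hr
      · exact absurd (congrArg (fun z : ↥U => (z : V)) (σ.injective heq)).symm q.2.2
      · rcases hab.lt_or_eq with hab | hab
        · exact (hσ (ι p) (ι q) ⟨x, hv⟩ hab hgt (G.adj_symm hp)).2.symm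
        · rw [← hι (σ.injective hab)]; exact hp
    · obtain ⟨q', hq', e⟩ := hcons x hx _ _ _ ⟨ι p, hp, rfl⟩ ⟨ι r, hr, rfl⟩ hab hbc
      rw [σ.injective e] at hq'
      exact hq'
  · intro u hu
    refine hfirst (ι u) u.2.2 fun y hy => (hle u ⟨y, y.2, hy⟩).1 ?_
    exact Fin.le_def.2 (by omega)

/-- In a canonical partition, the first vertex of the umbrella ordering lies in `N(I)`. -/
theorem IsCanonicalPTPartition.exists_adj_first {V : Type*} [Finite V] {G : SimpleGraph V}
    {I U : Set V} (hcan : IsCanonicalPTPartition G I U) {σ : ↥U ≃ Fin (Nat.card ↥U)}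
    (hσ : IsUmbrellaOrdering (G.induce U) σ)
    (hcons : ∀ v ∈ I, ∀ a b c : Fin (Nat.card ↥U),
      (∃ x : ↥U, G.Adj v ↑x ∧ σ x = a) → (∃ x : ↥U, G.Adj v ↑x ∧ σ x = c) →
      a ≤ b → b ≤ c → ∃ x : ↥U, G.Adj v ↑x ∧ σ x = b)
    {u : ↥U} (hu : (σ u : ℕ) = 0) (hN : openNbhd G I ⊆ insert ↑u (G.neighborSet ↑u)) :
    ∃ x ∈ I, G.Adj x u := by
  by_contra! hnot
  obtain ⟨⟨hIU, hdisj, hind, hunit, hth, -⟩, hmax⟩ := hcan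
  have hfst : ∀ y : ↥U, (y : V) ≠ u → σ u < σ y := by
    intro y hy
    have : (σ y : ℕ) ≠ σ u := fun e => hy (congrArg _ (σ.injective (Fin.ext e)))
    exact Fin.lt_def.2 (by omega)
  have hU : ∀ y, G.Adj u y → y ∈ U := by
    intro y hy
    have hy' : y ∈ I ∪ U := hIU ▸ Set.mem_univ y
    exact hy'.resolve_left fun hyI => hnot y hyI hy.symm
  have hNadj : ∀ z ∈ openNbhd G I, G.Adj u z := by
    intro z hz
    refine (hN hz).resolve_left ?_
    rintro rfl
    obtain ⟨-, x, hx, hxu⟩ := mem_openNbhd_iff.1 hz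
    exact hnot x hx hxu
  have hlt : ∀ y z : ↥U, G.Adj u y → G.Adj u z → σ y < σ z → G.Adj y z :=
    fun y z hy hz hyz => (hσ u y z (hfst y hy.ne') hyz hz).2
  have hsimp : IsSimplicial G u := by
    rintro y (rfl | hy) z (rfl | hz) hyz
    · exact absurd rfl hyz
    · exact hz
    · exact G.adj_symm hy
    · have hy' := hU y hy
      have hz' := hU z hz
      have hne : σ ⟨y, hy'⟩ ≠ σ ⟨z, hz'⟩ :=
        fun e => hyz (congrArg (fun t : ↥U => (t : V)) (σ.injective e))
      rcases hne.lt_or_gt with h | h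
      · exact hlt ⟨y, hy'⟩ ⟨z, hz'⟩ hy hz h
      · exact (hlt ⟨z, hz'⟩ ⟨y, hy'⟩ hz hy h).symm
  refine hmax u u.2 (isPairedThresholdPartition_insert hIU hdisj hind hunit σ hσ hcons u.2 hnot
    (isThresholdGraph_closedNbhd_insert hind (fun h => Set.disjoint_left.1 hdisj h u.2) hnot hsimp
      hNadj hth) ?_)
  intro t htu ht z hz
  obtain ⟨hzI, x, hx, hxz⟩ := mem_openNbhd_iff.1 hz
  have huz : G.Adj u z := by
    rcases hx with rfl | hx
    · exact hxz
    · exact hNadj z (mem_openNbhd_iff.2 ⟨fun h => hzI (Or.inr h), x, hx, hxz⟩)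
  rcases (ht ⟨z, hU z huz⟩ huz.ne').lt_or_eq with h | h
  · exact Or.inr (hσ u t ⟨z, hU z huz⟩ (hfst t htu) h huz).2
  · exact Or.inl (congrArg (fun t : ↥U => (t : V)) (σ.injective h)).symm

/-- If `I ⊎ U` is a canonical paired threshold partition of a
paired threshold graph `G` and `v ∈ U ∖ N(I)` is simplicial, then the
subgraph induced by `N[I ∪ {v}]` is not a threshold graph. -/
theorem canonical_partition_extended_not_threshold {V : Type*} [Fintype V]
    (G : SimpleGraph V) (hG : IsPairedThresholdGraph G) (I U : Set V)
    (hcan : IsCanonicalPTPartition G I U) (v : V) (hvU : v ∈ U)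
    (hvN : v ∉ openNbhd G I) (hsimp : IsSimplicial G v) :
    ¬ IsThresholdGraph (G.induce (closedNbhd G (insert v I))) := by
  intro hth
  obtain ⟨⟨hIU, hdisj, hind, hunit, -, σ, hσ, hcons, hN⟩, hmax⟩ := id hcan
  have hvI : ∀ x ∈ I, ¬ G.Adj x v := fun x hx hxv =>
    hvN (mem_openNbhd_iff.2 ⟨fun h => Set.disjoint_left.1 hdisj h hvU, x, hx, hxv⟩)
  have hind' : ∀ x ∈ insert v I, ∀ y ∈ insert v I, ¬ G.Adj x y := by
    rintro x (rfl | hx) y (rfl | hy)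
    · exact G.irrefl
    · exact fun e => hvI y hy e.symm
    · exact hvI x hx
    · exact hind x hx y hy
  refine hmax v hvU (isPairedThresholdPartition_insert hIU hdisj hind hunit σ hσ hcons hvU hvI
    hth ?_)
  have hpos : 0 < Nat.card ↥U := (σ ⟨v, hvU⟩).pos
  obtain ⟨u₀, hu₀⟩ := σ.surjective ⟨0, hpos⟩
  have hu₀' : (σ u₀ : ℕ) = 0 := by rw [hu₀]
  obtain ⟨x, hx, hxu⟩ := hcan.exists_adj_first hσ hcons hu₀' (hN u₀ hu₀')
  intro u _ hmin z hz
  have hu : u = u₀ := by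
    have h₀ := Fin.le_def.1 (hmin u₀ fun e => hvI x hx (e ▸ hxu))
    exact σ.injective (Fin.ext (by omega))
  subst hu
  obtain ⟨hzI, y, hy, hyz⟩ := mem_openNbhd_iff.1 hz
  have hzI' : z ∉ I := fun h => hzI (Or.inr h)
  rcases hy with rfl | hy
  · rcases neighborSet_subset_or_of_threshold hth hind' (Or.inr hx) (Or.inl rfl) with h | h
    · exact hN u hu₀' (mem_openNbhd_iff.2 ⟨hzI', x, hx, h hyz⟩)
    · by_cases hzu : z = u
      · exact Or.inl hzu
      · exact Or.inr (hsimp (Or.inr (h hxu)) (Or.inr hyz) (Ne.symm hzu))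
  · exact hN u hu₀' (mem_openNbhd_iff.2 ⟨hzI', y, hy, hyz⟩)
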